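/- arXiv:2306.07482 — 2 statements merged into one kernel-verified Lean document; each statement's English description precedes it below -/
import Mathlib

section
/- Let k ≥ 1 and α, β, γ ∈ ℝ_{>0}^k, and let α', β' be given by the update rule. Then ∏_{i=1}^k α'_i = ∏_{i=1}^k α_i and ∏_{i=1}^k β'_i = ∏_{i=1}^k β_i; consequently, for every z ∈ ℂ∖{0, β_1⋯β_k}, det φ^b(z;α',γ) = det φ^b(z;α,γ) and det φ^g(z;β') = det φ^g(z;β). -/
open scoped BigOperators

/-- The matrix `φ^b(z;α,γ)`: `diag(γ) + Σ_{i=1}^{k−1} α_i E_{i+1,i} + α_k z⁻¹ E_{1,k}`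
(indices here are 0-based). -/
noncomputable def phiB (k : ℕ) (z : ℂ) (α γ : Fin k → ℂ) : Matrix (Fin k) (Fin k) ℂ :=
  Matrix.of fun (i j : Fin k) =>
    (if i = j then γ i else 0) + (if (i : ℕ) = (j : ℕ) + 1 then α j else 0) +
      (if (i : ℕ) = 0 ∧ (j : ℕ) = k - 1 then α j * z⁻¹ else 0)

/-- Value of a `Fin k`-indexed vector at a natural number (1 outside range). -/
noncomputable def bval {k : ℕ} (β : Fin k → ℂ) (m : ℕ) : ℂ :=
  if h : m < k then β ⟨m, h⟩ else 1

/-- The matrix `φ^g(z;β) = (1 − β z⁻¹)⁻¹ G(z;β)` with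
`G_{ij} = β_j⋯β_{i−1}` for `i ≥ j` and `G_{ij} = z⁻¹ (β_j⋯β_k)(β_1⋯β_{i−1})` for `i < j`
(0-based indices). -/
noncomputable def phiG (k : ℕ) (z : ℂ) (β : Fin k → ℂ) : Matrix (Fin k) (Fin k) ℂ :=
  (1 - (∏ i, β i) * z⁻¹)⁻¹ •
    Matrix.of fun (i j : Fin k) =>
      if (j : ℕ) ≤ (i : ℕ) then ∏ m ∈ Finset.Ico (j : ℕ) (i : ℕ), bval β m
      else z⁻¹ * (∏ m ∈ Finset.Ico (j : ℕ) k, bval β m) * ∏ m ∈ Finset.Ico 0 (i : ℕ), bval β m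


/-- The update rule for `α`: `α'_i = α_{i−1}(α_i+γ_{i+1}β_i)/(α_{i−1}+γ_iβ_{i−1})`,
indices taken cyclically in `Fin k`. -/
noncomputable def updA (k : ℕ) [NeZero k] (α β γ : Fin k → ℝ) (i : Fin k) : ℝ :=
  α (i - 1) * (α i + γ (i + 1) * β i) / (α (i - 1) + γ i * β (i - 1))

/-- The update rule for `β`: `β'_i = β_{i−1}(α_i+γ_{i+1}β_i)/(α_{i−1}+γ_iβ_{i−1})`,
indices taken cyclically in `Fin k`. -/
noncomputable def updB (k : ℕ) [NeZero k] (α β γ : Fin k → ℝ) (i : Fin k) : ℝ :=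
  β (i - 1) * (α i + γ (i + 1) * β i) / (α (i - 1) + γ i * β (i - 1))

theorem det_eq_of_mul_diagonal {k : ℕ} {M N : Matrix (Fin k) (Fin k) ℂ} (d : Fin k → ℂ)
    (hd : ∀ i, d i ≠ 0) (h : ∀ i j, M i j * d j = d i * N i j) : M.det = N.det := by
  have hMN : M * Matrix.diagonal d = Matrix.diagonal d * N := by
    ext i j
    simp [h]
  have hdet := congrArg Matrix.det hMN
  rw [Matrix.det_mul, Matrix.det_mul, mul_comm, Matrix.det_diagonal] at hdet
  exact mul_left_cancel₀ (Finset.prod_ne_zero_iff.mpr fun i _ => hd i) hdet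

/-- The product of the first `n` entries of `β`. -/
noncomputable def prefixProd {k : ℕ} (β : Fin k → ℂ) (n : ℕ) : ℂ :=
  ∏ m ∈ Finset.range n, bval β m

theorem bval_fin {k : ℕ} (β : Fin k → ℂ) (i : Fin k) : bval β i = β i := by
  simp [bval]

theorem prefixProd_ne_zero {k : ℕ} {β : Fin k → ℂ} (hβ : ∀ i, β i ≠ 0) (n : ℕ) :
    prefixProd β n ≠ 0 := by
  refine Finset.prod_ne_zero_iff.mpr fun m _ => ?_
  unfold bval
  split_ifs
  exacts [hβ _, one_ne_zero]

theorem prefixProd_succ {k : ℕ} (β : Fin k → ℂ) (i : Fin k) :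
    prefixProd β (i + 1) = prefixProd β i * β i := by
  rw [prefixProd, Finset.prod_range_succ, bval_fin, prefixProd]

theorem prefixProd_card {k : ℕ} (β : Fin k → ℂ) : prefixProd β k = ∏ i, β i := by
  simp [prefixProd, Finset.prod_range, bval_fin]

theorem prod_Ico_bval {k : ℕ} {β : Fin k → ℂ} (hβ : ∀ i, β i ≠ 0) {m n : ℕ} (h : m ≤ n) :
    ∏ l ∈ Finset.Ico m n, bval β l = prefixProd β n / prefixProd β m := by
  rw [eq_div_iff (prefixProd_ne_zero hβ m), mul_comm]
  exact Finset.prod_range_mul_prod_Ico _ h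

theorem det_phiB_congr {k : ℕ} (z : ℂ) {α α' : Fin k → ℂ} (γ : Fin k → ℂ)
    (hα : ∀ i, α i ≠ 0) (hα' : ∀ i, α' i ≠ 0) (h : ∏ i, α' i = ∏ i, α i) :
    (phiB k z α' γ).det = (phiB k z α γ).det := by
  have hP := prefixProd_ne_zero hα
  have hP' := prefixProd_ne_zero hα'
  refine det_eq_of_mul_diagonal (fun i => prefixProd α' i / prefixProd α i)
    (fun i => div_ne_zero (hP' i) (hP i)) fun i j => ?_
  have hj := hP j
  have hi := hP i
  have hs := prefixProd_succ α j
  have hs' := prefixProd_succ α' j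
  have hdiag : (if i = j then γ i else 0) * (prefixProd α' j / prefixProd α j) =
      prefixProd α' i / prefixProd α i * (if i = j then γ i else 0) := by
    split_ifs with hij
    · rw [hij, mul_comm]
    · simp
  have hsub : (if (i : ℕ) = j + 1 then α' j else 0) * (prefixProd α' j / prefixProd α j) =
      prefixProd α' i / prefixProd α i * (if (i : ℕ) = j + 1 then α j else 0) := by
    split_ifs with hij
    · have := hα j
      rw [hij, hs, hs']
      field_simp
    · simp
  have hcorner : (if (i : ℕ) = 0 ∧ (j : ℕ) = k - 1 then α' j * z⁻¹ else 0) *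
        (prefixProd α' j / prefixProd α j) =
      prefixProd α' i / prefixProd α i *
        (if (i : ℕ) = 0 ∧ (j : ℕ) = k - 1 then α j * z⁻¹ else 0) := by
    split_ifs with hij
    · have hk : (j : ℕ) + 1 = k := by have := j.isLt; omega
      have hfull : prefixProd α' j * α' j = prefixProd α j * α j := by
        rw [← hs, ← hs', hk, prefixProd_card, prefixProd_card, h]
      rw [hij.1]
      simp only [prefixProd, Finset.range_zero, Finset.prod_empty] at hfull hj ⊢
      field_simp
      linear_combination z⁻¹ * hfull
    · simp
  simp only [phiB, Matrix.of_apply, add_mul, mul_add, hdiag, hsub, hcorner]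

theorem det_phiG_congr {k : ℕ} (z : ℂ) {β β' : Fin k → ℂ}
    (hβ : ∀ i, β i ≠ 0) (hβ' : ∀ i, β' i ≠ 0) (h : ∏ i, β' i = ∏ i, β i) :
    (phiG k z β').det = (phiG k z β).det := by
  have hP := prefixProd_ne_zero hβ
  have hP' := prefixProd_ne_zero hβ'
  refine det_eq_of_mul_diagonal (fun i => prefixProd β' i / prefixProd β i)
    (fun i => div_ne_zero (hP' i) (hP i)) fun i j => ?_
  have hi := hP i
  have hj := hP j
  have hj' := hP' j
  simp only [phiG, Matrix.smul_apply, Matrix.of_apply, smul_eq_mul, h]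
  rw [mul_assoc, mul_left_comm (_ / _)]
  congr 1
  split_ifs with hij
  · rw [prod_Ico_bval hβ hij, prod_Ico_bval hβ' hij]
    field_simp
  · rw [prod_Ico_bval hβ j.isLt.le, prod_Ico_bval hβ' j.isLt.le, prefixProd_card,
      prefixProd_card, h, ← Finset.range_eq_Ico]
    change z⁻¹ * _ * prefixProd β' i * _ = _ * (z⁻¹ * _ * prefixProd β i)
    field_simp

theorem prod_mul_shift_div {k : ℕ} [NeZero k] (f s : Fin k → ℝ) (hs : ∀ i, s i ≠ 0) :
    ∏ i, f (i - 1) * s i / s (i - 1) = ∏ i, f i := by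
  have hshift (g : Fin k → ℝ) : ∏ i, g (i - 1) = ∏ i, g i :=
    Equiv.prod_comp (Equiv.subRight 1) g
  rw [Finset.prod_div_distrib, Finset.prod_mul_distrib, hshift f, hshift s]
  exact mul_div_cancel_right₀ _ (Finset.prod_ne_zero_iff.mpr fun i _ => hs i)

/-- The update rule preserves the products of the `α`'s and of the `β`'s; consequently the
determinants of `φ^b` and `φ^g` are unchanged. -/
theorem statement6 (k : ℕ) [NeZero k] (α β γ : Fin k → ℝ)
    (hα : ∀ i, 0 < α i) (hβ : ∀ i, 0 < β i) (hγ : ∀ i, 0 < γ i) :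
    (∏ i, updA k α β γ i = ∏ i, α i) ∧ (∏ i, updB k α β γ i = ∏ i, β i) ∧
    ∀ z : ℂ, z ≠ 0 → z ≠ ∏ i, (β i : ℂ) →
      (phiB k z (fun i => (updA k α β γ i : ℂ)) (fun i => (γ i : ℂ))).det =
        (phiB k z (fun i => (α i : ℂ)) (fun i => (γ i : ℂ))).det ∧
      (phiG k z (fun i => (updB k α β γ i : ℂ))).det =
        (phiG k z (fun i => (β i : ℂ))).det := by
  have hs (i : Fin k) : 0 < α i + γ (i + 1) * β i :=
    add_pos (hα _) (mul_pos (hγ _) (hβ _))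
  have hs' (i : Fin k) : 0 < α (i - 1) + γ i * β (i - 1) :=
    add_pos (hα _) (mul_pos (hγ _) (hβ _))
  have hA : ∏ i, updA k α β γ i = ∏ i, α i := by
    simpa only [updA, sub_add_cancel] using
      prod_mul_shift_div α (fun i => α i + γ (i + 1) * β i) fun i => (hs i).ne'
  have hB : ∏ i, updB k α β γ i = ∏ i, β i := by
    simpa only [updB, sub_add_cancel] using
      prod_mul_shift_div β (fun i => α i + γ (i + 1) * β i) fun i => (hs i).ne'
  have hApos (i : Fin k) : 0 < updA k α β γ i := div_pos (mul_pos (hα _) (hs i)) (hs' i)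
  have hBpos (i : Fin k) : 0 < updB k α β γ i := div_pos (mul_pos (hβ _) (hs i)) (hs' i)
  refine ⟨hA, hB, fun z _ _ => ⟨det_phiB_congr z _ ?_ ?_ ?_, det_phiG_congr z ?_ ?_ ?_⟩⟩
  · exact fun i => Complex.ofReal_ne_zero.mpr (hα i).ne'
  · exact fun i => Complex.ofReal_ne_zero.mpr (hApos i).ne'
  · exact_mod_cast hA
  · exact fun i => Complex.ofReal_ne_zero.mpr (hβ i).ne'
  · exact fun i => Complex.ofReal_ne_zero.mpr (hBpos i).ne'
  · exact_mod_cast hB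
end

section
/- For all z ∈ ℂ with z ≠ 0 and z ≠ β^v_i for every i = 1,…,ℓ, and all w ∈ ℂ, one has P(z,w) = det K_{G_1}(z,w). -/
open scoped BigOperators Matrix

/-- `Φ(z) = φ_1(z)φ_2(z)⋯φ_{2ℓ}(z)` where `φ_{2i−1}(z) = φ^b(z;α⃗_i,γ⃗_i)` and
`φ_{2i}(z) = φ^g(z;β⃗_i)`. -/
noncomputable def PhiM (k ℓ : ℕ) (α β γ : Fin k → Fin ℓ → ℝ) (z : ℂ) :
    Matrix (Fin k) (Fin k) ℂ :=
  (List.ofFn fun i : Fin ℓ =>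
    phiB k z (fun j => (α j i : ℂ)) (fun j => (γ j i : ℂ)) *
      phiG k z (fun j => (β j i : ℂ))).prod

/-- The characteristic polynomial `P(z,w) = ∏_{i=1}^ℓ (1−β^v_i z⁻¹) · det(Φ(z)−wI)`. -/
noncomputable def PP (k ℓ : ℕ) (α β γ : Fin k → Fin ℓ → ℝ) (z w : ℂ) : ℂ :=
  (∏ i : Fin ℓ, (1 - (∏ j, (β j i : ℂ)) * z⁻¹)) *
    (PhiM k ℓ α β γ z - w • (1 : Matrix (Fin k) (Fin k) ℂ)).det

/-- The magnetically altered Kasteleyn matrix `K_{G_1}(z,w)`, an `ℓ×ℓ` array of `k×k`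
blocks: diagonal blocks `A_i = φ_{2i−1}(z)ᵀ`, superdiagonal blocks
`B_i = −φ^b(z;−β⃗_i,1)ᵀ`, and corner block `w·B_ℓ` (for `ℓ = 1` the single block is
`A_1 + w·B_1`).  Rows are indexed by white labels, columns by black labels. -/
noncomputable def Kmat (k ℓ : ℕ) (α β γ : Fin k → Fin ℓ → ℝ) (z w : ℂ) :
    Matrix (Fin ℓ × Fin k) (Fin ℓ × Fin k) ℂ :=
  Matrix.of fun p q =>
    (if q.1 = p.1 then
        (phiB k z (fun j => (α j p.1 : ℂ)) (fun j => (γ j p.1 : ℂ)))ᵀ p.2 q.2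
      else 0) +
    (if (q.1 : ℕ) = ((p.1 : ℕ) + 1) % ℓ then
        (if (p.1 : ℕ) = ℓ - 1 then w else 1) *
          (-(phiB k z (fun j => (-(β j p.1 : ℂ))) (fun _ => 1))ᵀ p.2 q.2)
      else 0)

section BlockMatrices

variable {κ : Type*} [Fintype κ] [DecidableEq κ] {n : ℕ}

/-- The determinant of a block upper triangular matrix is the product of the determinants of its
diagonal blocks. -/
theorem det_comp_of_upperTriangular {m : ℕ} (X : Matrix (Fin m) (Fin m) (Matrix κ κ ℂ))
    (hX : ∀ i j, j < i → X i j = 0) :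
    (Matrix.comp _ _ _ _ ℂ X).det = ∏ i, (X i i).det := by
  have hT : (Matrix.comp _ _ _ _ ℂ X).BlockTriangular Prod.fst := by
    intro p q h
    simp [Matrix.comp_apply, hX _ _ h]
  rw [hT.det_fintype]
  refine Finset.prod_congr rfl fun i _ => ?_
  let e : κ ≃ {p : Fin m × κ // p.1 = i} :=
    { toFun := fun a => ⟨(i, a), rfl⟩
      invFun := fun p => p.1.2
      left_inv := fun _ => rfl
      right_inv := by rintro ⟨⟨_, _⟩, rfl⟩; rfl }
  rw [← Matrix.det_submatrix_equiv_self e]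
  rfl

/-- The cyclic bidiagonal matrix over a ring with diagonal `f`, entries `-1` below the diagonal
and entry `-W` in the upper right corner (subtracted from the diagonal entry when `n = 0`). -/
def cyclicBidiagonal {R : Type*} [Ring R] (f : Fin (n + 1) → R) (W : R) :
    Matrix (Fin (n + 1)) (Fin (n + 1)) R :=
  Matrix.of fun i j =>
    (if i = j then f i else 0) - (if i = j + 1 then (if j = Fin.last n then W else 1) else 0)

/-- The unipotent matrix eliminating the first row of `cyclicBidiagonal f W` up to its last
entry. -/
def partialProdRow {R : Type*} [Ring R] (f : Fin (n + 1) → R) :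
    Matrix (Fin (n + 1)) (Fin (n + 1)) R :=
  Matrix.of fun i j => if i = 0 then Fin.partialProd f j.castSucc else if i = j then 1 else 0

theorem partialProdRow_mul_cyclicBidiagonal {R : Type*} [Ring R] (f : Fin (n + 1) → R) (W : R)
    (i j : Fin (n + 1)) :
    (partialProdRow f * cyclicBidiagonal f W) i j =
      if i = 0 then (if j = Fin.last n then (List.ofFn f).prod - W else 0)
      else cyclicBidiagonal f W i j := by
  rw [Matrix.mul_apply]
  by_cases hi : i = 0
  · simp only [partialProdRow, cyclicBidiagonal, Matrix.of_apply, hi, if_true, mul_sub,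
      Finset.sum_sub_distrib, mul_ite, mul_zero, Finset.sum_ite_eq', Finset.mem_univ, mul_one]
    rw [← Fin.partialProd_succ]
    rcases Fin.eq_castSucc_or_eq_last j with ⟨j, rfl⟩ | rfl
    · simp [Fin.castSucc_ne_last]
    · have : Fin.partialProd f (Fin.last n).succ = (List.ofFn f).prod := by
        rw [Fin.partialProd, List.take_of_length_le (by simp)]
      rw [if_pos rfl, if_pos rfl, this]
      simp
  · simp [partialProdRow, hi]

/-- The determinant of a block cyclic bidiagonal matrix. -/
theorem det_comp_cyclicBidiagonal (f : Fin (n + 1) → Matrix κ κ ℂ) (W : Matrix κ κ ℂ) :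
    (Matrix.comp _ _ _ _ ℂ (cyclicBidiagonal f W)).det = ((List.ofFn f).prod - W).det := by
  have hU : (Matrix.comp _ _ _ _ ℂ (partialProdRow f)).det = 1 := by
    rw [det_comp_of_upperTriangular]
    · refine Finset.prod_eq_one fun i _ => ?_
      by_cases hi : i = 0 <;> simp [partialProdRow, hi]
    · intro i j h
      simp [partialProdRow, h.ne', (Fin.zero_le j).trans_lt h |>.ne']
  have hsub := Matrix.det_permute ((finRotate (n + 1)).prodCongr (Equiv.refl κ))
    (Matrix.comp _ _ _ _ ℂ (partialProdRow f * cyclicBidiagonal f W))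
  have hcomp : (Matrix.comp _ _ _ _ ℂ (partialProdRow f * cyclicBidiagonal f W)) =
      Matrix.comp _ _ _ _ ℂ (partialProdRow f) * Matrix.comp _ _ _ _ ℂ (cyclicBidiagonal f W) :=
    map_mul (Matrix.compRingEquiv (Fin (n + 1)) κ ℂ) _ _
  have hrot : ((Matrix.comp _ _ _ _ ℂ (partialProdRow f * cyclicBidiagonal f W)).submatrix
      ((finRotate (n + 1)).prodCongr (Equiv.refl κ)) id).det =
      (-1) ^ (n * Fintype.card κ) * ((List.ofFn f).prod - W).det := by
    have := det_comp_of_upperTriangular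
      ((partialProdRow f * cyclicBidiagonal f W).submatrix (finRotate (n + 1)) id) (by
        intro i j h
        rw [Matrix.submatrix_apply, finRotate_apply, partialProdRow_mul_cyclicBidiagonal]
        rcases Fin.eq_castSucc_or_eq_last i with ⟨i, rfl⟩ | rfl
        · have h1 : i.succ ≠ j := by
            rintro rfl
            exact absurd h (by simp [Fin.lt_def])
          have h2 : i.succ ≠ j + 1 := by
            rw [← Fin.coeSucc_eq_succ]
            exact fun h' => h.ne' (add_right_cancel h')
          simp [cyclicBidiagonal, h1, h2]
        · simp [h.ne])
    refine Eq.trans this ?_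
    rw [Fin.prod_univ_castSucc]
    congr 1
    · rw [pow_mul, Finset.prod_eq_pow_card (b := (-1) ^ Fintype.card κ)]
      · simp [← pow_mul, mul_comm]
      · intro i _
        rw [Matrix.submatrix_apply, finRotate_apply, partialProdRow_mul_cyclicBidiagonal]
        simp [cyclicBidiagonal, Fin.castSucc_ne_last, Fin.castSucc_lt_succ.ne', Matrix.det_neg]
    · rw [Matrix.submatrix_apply, finRotate_apply, partialProdRow_mul_cyclicBidiagonal]
      simp
  have hsign : Equiv.Perm.sign ((finRotate (n + 1)).prodCongr (Equiv.refl κ)) =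
      (-1) ^ (n * Fintype.card κ) := by
    have : ((finRotate (n + 1)).prodCongr (Equiv.refl κ) : Equiv.Perm _) =
        Equiv.prodCongrLeft fun _ : κ => finRotate (n + 1) := by
      ext <;> rfl
    rw [this, Equiv.Perm.sign_prodCongrLeft]
    simp [pow_mul]
  rw [hrot, hsign, hcomp, Matrix.det_mul, hU, one_mul] at hsub
  push_cast at hsub
  exact (mul_left_cancel₀ (pow_ne_zero _ (by norm_num)) hsub).symm

end BlockMatrices

theorem phiB_succ (m : ℕ) (z : ℂ) (α γ : Fin (m + 1) → ℂ) :
    phiB (m + 1) z α γ = Matrix.of fun i j => (if i = j then γ i else 0) +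
      (if i = j + 1 then α j * (if j = Fin.last m then z⁻¹ else 1) else 0) := by
  ext i j
  simp only [phiB, Matrix.of_apply, add_assoc]
  congr 1
  rcases Fin.eq_castSucc_or_eq_last j with ⟨j, rfl⟩ | rfl
  · have : (j : ℕ) ≠ m := j.2.ne
    have hsucc : i = j.succ ↔ (i : ℕ) = j + 1 := by
      rw [Fin.ext_iff, Fin.val_succ]
    simp [hsucc, this, Fin.castSucc_ne_last]
  · have : (i : ℕ) ≠ m + 1 := i.2.ne
    simp [this, Fin.last_add_one]

/-- The determinant of `φ^b(z;-β,1)`. -/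
theorem det_phiB_neg_one {k : ℕ} (hk : 1 ≤ k) (z : ℂ) (β : Fin k → ℂ) (hβ : ∀ i, β i ≠ 0) :
    (phiB k z (fun j => -β j) (fun _ => 1)).det = 1 - (∏ i, β i) * z⁻¹ := by
  obtain ⟨m, rfl⟩ := Nat.exists_eq_add_of_le' hk
  have hfac : phiB (m + 1) z (fun j => -β j) (fun _ => 1) =
      cyclicBidiagonal (fun i => (β i)⁻¹) z⁻¹ * Matrix.diagonal β := by
    rw [phiB_succ]
    ext i j
    rw [Matrix.mul_diagonal]
    simp only [cyclicBidiagonal, Matrix.of_apply, sub_mul, ite_mul, zero_mul, mul_ite, mul_one,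
      one_mul, neg_mul]
    rw [sub_eq_add_neg]
    congr 1
    · split_ifs with h
      · subst h
        simp [hβ]
      · rfl
    · split_ifs <;> simp [mul_comm]
  have hdet : (cyclicBidiagonal (fun i => (β i)⁻¹) z⁻¹).det = (∏ i, (β i)⁻¹) - z⁻¹ := by
    have h := det_comp_cyclicBidiagonal
      (fun i => Matrix.scalar Unit (β i)⁻¹) (Matrix.scalar Unit z⁻¹)
    rw [← Matrix.det_submatrix_equiv_self (Equiv.prodUnique (Fin (m + 1)) Unit).symm] at h
    have hl : (List.ofFn fun i => Matrix.scalar Unit (β i)⁻¹).prod =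
        Matrix.scalar Unit (∏ i, (β i)⁻¹) := by
      rw [← List.prod_ofFn, map_list_prod, List.map_ofFn]
      rfl
    rw [hl, ← map_sub] at h
    convert h using 1
    · congr 1
      ext i j
      simp only [cyclicBidiagonal, Matrix.of_apply, Matrix.submatrix_apply, Matrix.comp_apply,
        Equiv.prodUnique_symm_apply]
      split_ifs <;> simp
    · simp
  rw [hfac, Matrix.det_mul, hdet, Matrix.det_diagonal, sub_mul, ← Finset.prod_mul_distrib]
  simp [hβ, mul_comm]

theorem prod_bval {k : ℕ} (β : Fin k → ℂ) : ∏ m ∈ Finset.Ico 0 k, bval β m = ∏ i, β i := by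
  rw [← Finset.range_eq_Ico, ← Fin.prod_univ_eq_prod_range]
  simp [bval]

theorem phiB_mul_phiG {k : ℕ} (hk : 1 ≤ k) (z : ℂ) (β : Fin k → ℂ)
    (h : 1 - (∏ i, β i) * z⁻¹ ≠ 0) :
    phiB k z (fun j => -β j) (fun _ => 1) * phiG k z β = 1 := by
  obtain ⟨m, rfl⟩ := Nat.exists_eq_add_of_le' hk
  rw [phiG, Matrix.mul_smul, inv_smul_eq_iff₀ h, phiB_succ]
  ext i j
  rw [Matrix.mul_apply]
  simp only [Matrix.of_apply, add_mul, Finset.sum_add_distrib, ite_mul, zero_mul, one_mul,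
    Finset.sum_ite_eq, Finset.mem_univ, if_true, Matrix.smul_apply, smul_eq_mul]
  have hb : ∀ i : Fin (m + 1), bval β i = β i := fun i => by
    rw [bval, dif_pos i.2]
  have hj : (∏ a ∈ Finset.Ico 0 (j : ℕ), bval β a) * ∏ a ∈ Finset.Ico (j : ℕ) (m + 1), bval β a =
      ∏ i, β i := by
    rw [Finset.prod_Ico_consecutive _ (Nat.zero_le _) j.2.le, prod_bval]
  have hsucc : ∀ a b : ℕ, a ≤ b → ∏ c ∈ Finset.Ico a (b + 1), bval β c =
      (∏ c ∈ Finset.Ico a b, bval β c) * bval β b := fun a b hab =>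
    Finset.prod_Ico_succ_top hab _
  rcases Fin.eq_zero_or_eq_succ i with rfl | ⟨i, rfl⟩
  · rw [Finset.sum_eq_single (Fin.last m)]
    · have hl := hsucc j m (Nat.le_of_lt_succ j.2)
      have hbl := hb (Fin.last m)
      rw [Fin.val_last] at hbl
      rw [hbl] at hl
      by_cases h0 : j = 0
      · subst h0
        simp at hl hj ⊢
        rw [← hj, hl]
        ring
      · have h0' : (0 : Fin (m + 1)) ≠ j := Ne.symm h0
        have h0'' : (j : ℕ) ≠ 0 := fun h => h0 (Fin.ext h)
        simp [h0', h0'', hl, Nat.le_of_lt_succ j.2]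
        ring
    · intro b _ hb
      rw [if_neg]
      intro h
      apply hb
      rw [← add_left_inj 1, ← h, Fin.last_add_one]
    · simp
  · rw [Finset.sum_eq_single i.castSucc]
    · have hbi := hb i.castSucc
      rw [Fin.val_castSucc] at hbi
      simp only [Fin.coeSucc_eq_succ, if_true, Fin.castSucc_ne_last, if_false, mul_one,
        Fin.val_succ, Fin.val_castSucc]
      rcases lt_trichotomy (j : ℕ) (i + 1) with hlt | heq | hgt
      · have hne : i.succ ≠ j := fun h => by simp [← h] at hlt
        simp [hlt.le, Nat.le_of_lt_succ hlt, hsucc _ _ (Nat.le_of_lt_succ hlt), hbi, hne]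
        ring
      · have he : i.succ = j := Fin.ext heq.symm
        rw [← he] at hj ⊢
        rw [← hj]
        simp [hsucc, Finset.prod_range_succ, hbi]
        ring
      · have hne : i.succ ≠ j := fun h => by simp [← h] at hgt
        simp [hgt.not_ge, (Nat.lt_of_succ_lt hgt).not_ge, Finset.prod_range_succ, hbi, hne]
        ring
    · intro b _ hb
      rw [if_neg]
      rw [← Fin.coeSucc_eq_succ]
      exact fun h => hb (add_right_cancel h).symm
    · simp

/-- `P(z,w) = det K_{G_1}(z,w)` for `z ≠ 0` with `z ≠ β^v_i` for all `i`. -/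
theorem statement7 (k ℓ : ℕ) (hk : 1 ≤ k) (hℓ : 1 ≤ ℓ)
    (α β γ : Fin k → Fin ℓ → ℝ)
    (hα : ∀ j i, 0 < α j i) (hβ : ∀ j i, 0 < β j i) (hγ : ∀ j i, 0 < γ j i)
    (z : ℂ) (hz : z ≠ 0) (hzβ : ∀ i : Fin ℓ, z ≠ ∏ j, (β j i : ℂ)) (w : ℂ) :
    PP k ℓ α β γ z w = (Kmat k ℓ α β γ z w).det := by
  obtain ⟨n, rfl⟩ := Nat.exists_eq_add_of_le' hℓ
  set a := fun i => phiB k z (fun j => (α j i : ℂ)) (fun j => (γ j i : ℂ))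
  set g := fun i => phiG k z (fun j => (β j i : ℂ))
  set c := fun i => phiB k z (fun j => -(β j i : ℂ)) (fun _ => 1) with hc
  have hgc : ∀ i, g i * c i = 1 := fun i => by
    refine mul_eq_one_comm.mp (phiB_mul_phiG hk z _ ?_)
    rw [← div_eq_mul_inv, sub_ne_zero]
    exact fun h => hzβ i ((div_eq_one_iff_eq hz).mp h.symm).symm
  have hK : (Kmat k (n + 1) α β γ z w)ᵀ = Matrix.comp _ _ _ _ ℂ
      (cyclicBidiagonal (fun i => a i * g i) (w • 1) * Matrix.diagonal c) := by
    ext p q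
    have hpq : (p.1 : ℕ) = ((q.1 : ℕ) + 1) % (n + 1) ↔ p.1 = q.1 + 1 := by
      simp [Fin.ext_iff, Fin.val_add]
    have hlast : (q.1 : ℕ) = n + 1 - 1 ↔ q.1 = Fin.last n := by simp [Fin.ext_iff]
    rw [Matrix.comp_apply, Matrix.mul_diagonal]
    simp only [Kmat, Matrix.transpose_apply, Matrix.of_apply, cyclicBidiagonal, hpq, hlast,
      sub_mul, ite_mul, zero_mul, one_mul, mul_assoc, smul_mul_assoc,
      Matrix.sub_apply]
    rw [sub_eq_add_neg]
    congr 1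
    · split_ifs with h
      · rw [h, hgc, mul_one]
      · rfl
    · split_ifs <;> simp [hc]
  have hmul : Matrix.comp _ _ _ _ ℂ
        (cyclicBidiagonal (fun i => a i * g i) (w • 1) * Matrix.diagonal c) =
      Matrix.comp _ _ _ _ ℂ (cyclicBidiagonal (fun i => a i * g i) (w • 1)) *
        Matrix.comp _ _ _ _ ℂ (Matrix.diagonal c) :=
    map_mul (Matrix.compRingEquiv (Fin (n + 1)) (Fin k) ℂ) _ _
  rw [← Matrix.det_transpose, hK, hmul, Matrix.det_mul, det_comp_cyclicBidiagonal,
    det_comp_of_upperTriangular _ fun i j h => Matrix.diagonal_apply_ne _ h.ne', mul_comm, PP,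
    PhiM]
  congr 1
  refine Finset.prod_congr rfl fun i _ => ?_
  rw [Matrix.diagonal_apply_eq]
  exact (det_phiB_neg_one hk z _ fun j => by exact_mod_cast (hβ j i).ne').symm
end
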